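/- arXiv:1510.05933 — 2 statements merged into one kernel-verified Lean document; each statement's English description precedes it below -/
import Mathlib

section
/- Let Λ ⊆ M be a compact invariant set for the homeomorphism f. Suppose W is an open neighborhood of Λ such that f is expansive with constant a > 0 on W and W has the shadowing property. Then Λ is locally maximal if and only if there exists δ > 0 such that every δ-pseudo-orbit contained in Λ is (a/2)-shadowed by a point of Λ. -/
/-- The `n`-th iterate (`n : ℤ`) of a homeomorphism. -/
def hIter {M : Type*} [TopologicalSpace M] (f : M ≃ₜ M) (n : ℤ) : M → M :=
  fun x => (((f.toEquiv : Equiv.Perm M)) ^ n) x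

/-- `y : ℤ → M` is an `ε`-pseudo-orbit for `f`. -/
def IsPseudoOrbit {M : Type*} [MetricSpace M] (f : M ≃ₜ M) (ε : ℝ) (y : ℤ → M) : Prop :=
  ∀ j : ℤ, dist (f (y j)) (y (j + 1)) < ε

/-- `x` δ-shadows the sequence `y`. -/
def Shadows {M : Type*} [MetricSpace M] (f : M ≃ₜ M) (δ : ℝ) (x : M) (y : ℤ → M) : Prop :=
  ∀ j : ℤ, dist (hIter f j x) (y j) ≤ δ

/-- `I_f(U) = ⋂_{n ∈ ℤ} fⁿ(U)`. -/
def invSet {M : Type*} [TopologicalSpace M] (f : M ≃ₜ M) (U : Set M) : Set M :=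
  ⋂ n : ℤ, hIter f n '' U

/-- A compact invariant set is locally maximal if it is the maximal invariant
set of some open neighborhood. -/
def LocallyMaximal {M : Type*} [TopologicalSpace M] (f : M ≃ₜ M) (Λ : Set M) : Prop :=
  ∃ U : Set M, IsOpen U ∧ Λ ⊆ U ∧ Λ = invSet f U

/-- `Λ` is premaximal: every open neighborhood contains a compact invariant
locally maximal set containing `Λ`. -/
def Premaximal {M : Type*} [TopologicalSpace M] (f : M ≃ₜ M) (Λ : Set M) : Prop :=
  ∀ U : Set M, IsOpen U → Λ ⊆ U →
    ∃ Λ' : Set M, IsCompact Λ' ∧ f '' Λ' = Λ' ∧ LocallyMaximal f Λ' ∧ Λ ⊆ Λ' ∧ Λ' ⊆ U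

/-- `f` is expansive with constant `a` on `W`. -/
def ExpansiveOn {M : Type*} [MetricSpace M] (f : M ≃ₜ M) (a : ℝ) (W : Set M) : Prop :=
  ∀ x y : M, (∀ n : ℤ, hIter f n x ∈ W) → (∀ n : ℤ, hIter f n y ∈ W) →
    (∀ n : ℤ, dist (hIter f n x) (hIter f n y) ≤ a) → x = y

/-- `W` has the shadowing property. -/
def HasShadowing {M : Type*} [MetricSpace M] (f : M ≃ₜ M) (W : Set M) : Prop :=
  ∀ ε > (0 : ℝ), ∃ δ > (0 : ℝ), ∀ y : ℤ → M, IsPseudoOrbit f δ y → (∀ j, y j ∈ W) →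
    ∃ x : M, Shadows f ε x y

/-- The shadowing closure `sh(Λ, δ)` (with expansivity constant `a`). -/
def shClosure {M : Type*} [MetricSpace M] (f : M ≃ₜ M) (a δ : ℝ) (Λ : Set M) : Set M :=
  closure {x : M | ∃ y : ℤ → M, IsPseudoOrbit f δ y ∧ (∀ j, y j ∈ Λ) ∧ Shadows f (a / 2) x y}

/-- The shadowing sequence `Λ₀ = Λ`, `Λ_{j+1} = sh(Λ_j, δ)`. -/
def shSeq {M : Type*} [MetricSpace M] (f : M ≃ₜ M) (a δ : ℝ) (Λ : Set M) : ℕ → Set M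
  | 0 => Λ
  | j + 1 => shClosure f a δ (shSeq f a δ Λ j)

theorem hIter_add_one {M : Type*} [TopologicalSpace M] (f : M ≃ₜ M) (n : ℤ) (x : M) :
    hIter f (n + 1) x = f (hIter f n x) := by
  simp only [hIter, add_comm n 1, zpow_add, zpow_one, Equiv.Perm.mul_apply]
  rfl

theorem mem_invSet_iff {M : Type*} [TopologicalSpace M] (f : M ≃ₜ M) (U : Set M) (x : M) :
    x ∈ invSet f U ↔ ∀ n : ℤ, hIter f n x ∈ U := by
  simp only [invSet, Set.mem_iInter]
  constructor
  · intro h n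
    obtain ⟨u, hu, rfl⟩ := h (-n)
    simpa [hIter] using hu
  · exact fun h n => ⟨hIter f (-n) x, h (-n), by simp [hIter]⟩

theorem hIter_mem_of_image_eq {M : Type*} [TopologicalSpace M] {f : M ≃ₜ M} {Λ : Set M}
    (hΛ : f '' Λ = Λ) {x : M} (hx : x ∈ Λ) (n : ℤ) : hIter f n x ∈ Λ := by
  have mem_iff (z : M) : f z ∈ Λ ↔ z ∈ Λ := by
    conv_lhs => rw [← hΛ]
    exact f.injective.mem_set_image
  induction n using Int.induction_on with
  | zero => simpa [hIter] using hx
  | succ n ih => rwa [hIter_add_one, mem_iff]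
  | pred n ih => rwa [← mem_iff, ← hIter_add_one, sub_add_cancel]

/-- A sequence that follows a true orbit closely is a pseudo-orbit. -/
theorem isPseudoOrbit_of_dist_hIter_lt {M : Type*} [MetricSpace M] {f : M ≃ₜ M} {r δ : ℝ}
    (hf : ∀ ⦃p q : M⦄, dist p q < r → dist (f p) (f q) < δ / 2) (hr : r ≤ δ / 2)
    {x : M} {y : ℤ → M} (hy : ∀ j, dist (hIter f j x) (y j) < r) : IsPseudoOrbit f δ y := by
  intro j
  have h₁ : dist (f (y j)) (f (hIter f j x)) < δ / 2 := hf (dist_comm (y j) _ ▸ hy j)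
  have h₂ := hy (j + 1)
  rw [hIter_add_one] at h₂
  linarith [dist_triangle (f (y j)) (f (hIter f j x)) (y (j + 1))]

/-- `Λ` is locally maximal iff it has internal shadowing. -/
theorem locallyMaximal_iff_internal_shadowing
    {M : Type*} [MetricSpace M] [CompactSpace M] (f : M ≃ₜ M)
    (Λ W : Set M) (a : ℝ)
    (hΛc : IsCompact Λ) (hΛinv : f '' Λ = Λ)
    (hW : IsOpen W) (hΛW : Λ ⊆ W)
    (ha : 0 < a) (hexp : ExpansiveOn f a W) (hshad : HasShadowing f W) :
    LocallyMaximal f Λ ↔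
      ∃ δ : ℝ, 0 < δ ∧ ∀ y : ℤ → M, IsPseudoOrbit f δ y → (∀ j, y j ∈ Λ) →
        ∃ x ∈ Λ, Shadows f (a / 2) x y := by
  constructor
  · rintro ⟨U, hU, hΛU, hmax⟩
    obtain ⟨r, hr, hrU⟩ := hΛc.exists_cthickening_subset_open hU hΛU
    obtain ⟨δ, hδ, hsh⟩ := hshad (min r (a / 2)) (lt_min hr (half_pos ha))
    refine ⟨δ, hδ, fun y hy hyΛ => ?_⟩
    obtain ⟨x, hx⟩ := hsh y hy fun j => hΛW (hyΛ j)
    refine ⟨x, ?_, fun j => (hx j).trans (min_le_right _ _)⟩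
    rw [hmax, mem_invSet_iff]
    exact fun n => hrU <| Metric.mem_cthickening_of_dist_le _ _ _ _ (hyΛ n)
      ((hx n).trans (min_le_left _ _))
  · rintro ⟨δ, hδ, hsh⟩
    obtain ⟨s, hs, hsW⟩ := hΛc.exists_thickening_subset_open hW hΛW
    obtain ⟨t, ht, hft⟩ := Metric.uniformContinuous_iff.1
      (CompactSpace.uniformContinuous_of_continuous f.continuous) (δ / 2) (half_pos hδ)
    obtain ⟨r, hr, hrlt⟩ := exists_between
      (show 0 < min (min s t) (min (δ / 2) (a / 2)) by positivity)
    simp only [lt_min_iff] at hrlt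
    obtain ⟨⟨hrs, hrt⟩, hrδ, hra⟩ := hrlt
    have hΛU : Λ ⊆ Metric.thickening r Λ := Metric.self_subset_thickening hr Λ
    refine ⟨Metric.thickening r Λ, Metric.isOpen_thickening, hΛU, Set.Subset.antisymm ?_ ?_⟩
    · exact fun x hx => (mem_invSet_iff f _ x).2 fun n =>
        hΛU (hIter_mem_of_image_eq hΛinv hx n)
    · intro x hx
      rw [mem_invSet_iff] at hx
      choose y hyΛ hy using fun j => Metric.mem_thickening_iff.1 (hx j)
      obtain ⟨z, hz, hzy⟩ := hsh y
        (isPseudoOrbit_of_dist_hIter_lt (fun p q h => hft (h.trans hrt)) hrδ.le hy) hyΛ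
      have hxz : x = z := by
        refine hexp x z (fun n => hsW (Metric.thickening_mono hrs.le Λ (hx n)))
          (fun n => hΛW (hIter_mem_of_image_eq hΛinv hz n)) fun n => ?_
        linarith [dist_triangle_right (hIter f n x) (hIter f n z) (y n), hy n, hzy n]
      exact hxz ▸ hz
end

section
/- Let f : M → M and f' : M' → M' be homeomorphisms of compact metric spaces, and let Λ ⊆ M and Λ' ⊆ M' be compact invariant sets. Assume there are open neighborhoods W of Λ and W' of Λ' such that f is expansive with some constant a > 0 on W and W has the shadowing property, and f' is expansive with some constant a' > 0 on W' and W' has the shadowing property. If there is a homeomorphism h : Λ → Λ' with h ∘ f = f' ∘ h on Λ, then Λ is premaximal for f if and only if Λ' is premaximal for f'. -/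
open Metric Set

section Iterates

variable {M : Type*} [TopologicalSpace M] (f : M ≃ₜ M)

lemma hIter_zero (x : M) : hIter f 0 x = x := by simp [hIter]

lemma hIter_add (m n : ℤ) (x : M) : hIter f (m + n) x = hIter f m (hIter f n x) := by
  simp [hIter, zpow_add]

lemma hIter_one (x : M) : hIter f 1 x = f x := by simp [hIter]

lemma hIter_succ (n : ℤ) (x : M) : hIter f (n + 1) x = f (hIter f n x) := by
  rw [add_comm, hIter_add, hIter_one]

lemma hIter_hIter_neg (n : ℤ) (x : M) : hIter f n (hIter f (-n) x) = x := by
  rw [← hIter_add, add_neg_cancel, hIter_zero]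

lemma continuous_hIter (n : ℤ) : Continuous (hIter f n) := by
  induction n using Int.induction_on with
  | zero => exact continuous_id.congr fun x => (hIter_zero f x).symm
  | succ n ih => exact (f.continuous.comp ih).congr fun x => (hIter_succ f n x).symm
  | pred n ih =>
    refine (f.symm.continuous.comp ih).congr fun x => ?_
    rw [Function.comp_apply, Homeomorph.symm_apply_eq, ← hIter_succ, sub_add_cancel]

lemma hIter_mem {Λ : Set M} (hΛ : f '' Λ = Λ) (n : ℤ) {x : M} (hx : x ∈ Λ) :
    hIter f n x ∈ Λ := by
  induction n using Int.induction_on with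
  | zero => rwa [hIter_zero]
  | succ n ih => rw [hIter_succ, ← hΛ]; exact mem_image_of_mem f ih
  | pred n ih =>
    rw [← hΛ] at ih
    obtain ⟨y, hy, hyx⟩ := ih
    rw [← sub_add_cancel (-(n : ℤ)) 1, hIter_succ, f.injective.eq_iff] at hyx
    exact hyx ▸ hy

lemma image_eq_of_forall_hIter_mem {Λ : Set M} (hΛ : ∀ x ∈ Λ, ∀ n, hIter f n x ∈ Λ) :
    f '' Λ = Λ := by
  refine Subset.antisymm ?_ fun x hx => ⟨hIter f (-1) x, hΛ x hx _, ?_⟩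
  · rintro _ ⟨x, hx, rfl⟩
    exact hIter_one f x ▸ hΛ x hx 1
  · rw [← hIter_one, hIter_hIter_neg]

lemma mem_invSet {U : Set M} {x : M} : x ∈ invSet f U ↔ ∀ n, hIter f n x ∈ U := by
  simp only [invSet, mem_iInter]
  constructor
  · intro hx n
    obtain ⟨y, hy, hyx⟩ := hx (-n)
    rwa [← hyx, hIter_hIter_neg]
  · exact fun hx n => ⟨hIter f (-n) x, hx _, hIter_hIter_neg f n x⟩

end Iterates

/-- The inverse of a compact relation that is injective is uniformly continuous. -/
lemma IsCompact.exists_dist_fst_lt {X Y : Type*} [PseudoMetricSpace X] [MetricSpace Y]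
    {K : Set (X × Y)} (hK : IsCompact K)
    (hinj : ∀ p ∈ K, ∀ q ∈ K, p.2 = q.2 → p.1 = q.1) {δ : ℝ} (hδ : 0 < δ) :
    ∃ σ > 0, ∀ p ∈ K, ∀ q ∈ K, dist p.2 q.2 < σ → dist p.1 q.1 < δ := by
  have hC : IsCompact ((K ×ˢ K) ∩ {r | δ ≤ dist r.1.1 r.2.1}) :=
    (hK.prod hK).inter_right (isClosed_le continuous_const (by fun_prop))
  rcases Set.eq_empty_or_nonempty ((K ×ˢ K) ∩ {r | δ ≤ dist r.1.1 r.2.1}) with he | hne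
  · refine ⟨1, one_pos, fun p hp q hq _ => not_le.1 fun hle => ?_⟩
    have : (p, q) ∈ (K ×ˢ K) ∩ {r | δ ≤ dist r.1.1 r.2.1} := ⟨⟨hp, hq⟩, hle⟩
    simp [he] at this
  · obtain ⟨r, ⟨⟨hr₁, hr₂⟩, hr⟩, hmin⟩ := hC.exists_isMinOn hne
      (f := fun r => dist r.1.2 r.2.2) (by fun_prop)
    refine ⟨dist r.1.2 r.2.2, dist_pos.2 fun heq => ?_, fun p hp q hq hlt => not_le.1 fun hle => ?_⟩
    · rw [mem_ofPred_eq, hinj _ hr₁ _ hr₂ heq, dist_self] at hr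
      exact absurd hr (not_le.2 hδ)
    · exact absurd (hmin (show (p, q) ∈ _ from ⟨⟨hp, hq⟩, hle⟩)) (not_le.2 hlt)

/-- Points close to a pair in a compact relation form a closed set. -/
lemma IsCompact.isClosed_exists_dist_le {X Y : Type*} [MetricSpace X] [CompactSpace X]
    [MetricSpace Y] [CompactSpace Y] {K : Set (X × Y)} (hK : IsCompact K) (r s : ℝ) :
    IsClosed {p : X × Y | ∃ q ∈ K, dist p.1 q.1 ≤ r ∧ dist p.2 q.2 ≤ s} := by
  have hC : IsCompact ((K ×ˢ (univ : Set (X × Y))) ∩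
      {t | dist t.2.1 t.1.1 ≤ r ∧ dist t.2.2 t.1.2 ≤ s}) :=
    (hK.prod isCompact_univ).inter_right <| by
      simp only [ofPred_and]
      exact (isClosed_le (by fun_prop) continuous_const).inter
        (isClosed_le (by fun_prop) continuous_const)
  convert (hC.image continuous_snd).isClosed using 1
  ext p
  constructor
  · rintro ⟨q, hq, h⟩
    exact ⟨(q, p), ⟨⟨hq, trivial⟩, h⟩, rfl⟩
  · rintro ⟨⟨q, p⟩, ⟨⟨hq, -⟩, h⟩, rfl⟩
    exact ⟨q, hq, h⟩

/-- Near any orbit, all uniformly close sequences are pseudo-orbits. -/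
lemma exists_isPseudoOrbit_of_near_orbit {M : Type*} [MetricSpace M] [CompactSpace M]
    (f : M ≃ₜ M) {σ : ℝ} (hσ : 0 < σ) :
    ∃ ρ > 0, ρ < σ ∧ ∀ (z : M) (y : ℤ → M), (∀ j, dist (hIter f j z) (y j) < ρ) →
      IsPseudoOrbit f σ y := by
  obtain ⟨θ, hθ, hf⟩ := Metric.uniformContinuous_iff.1
    (CompactSpace.uniformContinuous_of_continuous f.continuous) (σ / 2) (half_pos hσ)
  refine ⟨min θ (σ / 2), by positivity, (min_le_right _ _).trans_lt (half_lt_self hσ),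
    fun z y hy j => ?_⟩
  have h₁ := hf ((hy j).trans_le (min_le_left _ _))
  have h₂ := (hy (j + 1)).trans_le (min_le_right _ _)
  rw [hIter_succ] at h₂
  have := dist_triangle_left (f (y j)) (y (j + 1)) (f (hIter f j z))
  linarith

/-- A locally maximal set inside a set with shadowing contains the points shadowing its own
pseudo-orbits. -/
lemma LocallyMaximal.exists_shadows_mem {M : Type*} [MetricSpace M] {f : M ≃ₜ M}
    {Λ W : Set M} (hΛ : IsCompact Λ)
    (hmax : LocallyMaximal f Λ) (hΛW : Λ ⊆ W) (hW : HasShadowing f W) {ε : ℝ} (hε : 0 < ε) :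
    ∃ δ > 0, ∀ y : ℤ → M, IsPseudoOrbit f δ y → (∀ j, y j ∈ Λ) →
      ∃ x ∈ Λ, Shadows f ε x y := by
  obtain ⟨U, hU, hΛU, hinv⟩ := hmax
  obtain ⟨τ, hτ, hτU⟩ := hΛ.exists_cthickening_subset_open hU hΛU
  obtain ⟨δ, hδ, hsh⟩ := hW (min τ ε) (lt_min hτ hε)
  refine ⟨δ, hδ, fun y hy hyΛ => ?_⟩
  obtain ⟨x, hx⟩ := hsh y hy fun j => hΛW (hyΛ j)
  refine ⟨x, ?_, fun j => (hx j).trans (min_le_right _ _)⟩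
  rw [hinv, mem_invSet]
  exact fun n => hτU (mem_cthickening_of_dist_le _ _ _ _ (hyΛ n) ((hx n).trans (min_le_left _ _)))

lemma hIter_mem_graph {M M' : Type*} [TopologicalSpace M] [TopologicalSpace M'] {f : M ≃ₜ M}
    {f' : M' ≃ₜ M'} {G : Set (M × M')} (hinj : ∀ p ∈ G, ∀ q ∈ G, p.1 = q.1 → p.2 = q.2)
    (hGf : ∀ p ∈ G, (f p.1, f' p.2) ∈ G) (hinv : f '' (Prod.fst '' G) = Prod.fst '' G)
    {p : M × M'} (hp : p ∈ G) (n : ℤ) : (hIter f n p.1, hIter f' n p.2) ∈ G := by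
  induction n using Int.induction_on with
  | zero => simpa only [hIter_zero] using hp
  | succ n ih => simpa only [hIter_succ] using hGf _ ih
  | pred n ih =>
    obtain ⟨q, hq, hqp⟩ := hIter_mem f hinv (-n - 1) (mem_image_of_mem Prod.fst hp)
    have h₁ : f q.1 = hIter f (-n) p.1 := by rw [hqp, ← hIter_succ, sub_add_cancel]
    have h₂ : f' q.2 = hIter f' (-n) p.2 := hinj _ (hGf q hq) _ ih h₁
    rw [← sub_add_cancel (-(n : ℤ)) 1, hIter_succ, f'.injective.eq_iff] at h₂
    rwa [← hqp, ← h₂]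

/-- Premaximality passes along a conjugacy given by its graph `G`. -/
lemma Premaximal.of_graph {M : Type*} [MetricSpace M] [CompactSpace M]
    {M' : Type*} [MetricSpace M'] [CompactSpace M'] {f : M ≃ₜ M} {f' : M' ≃ₜ M'}
    {G : Set (M × M')} (hG : IsCompact G)
    (hinj₁ : ∀ p ∈ G, ∀ q ∈ G, p.2 = q.2 → p.1 = q.1)
    (hinj₂ : ∀ p ∈ G, ∀ q ∈ G, p.1 = q.1 → p.2 = q.2)
    (hGf : ∀ p ∈ G, (f p.1, f' p.2) ∈ G)
    (hΛinv : f '' (Prod.fst '' G) = Prod.fst '' G)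
    {W : Set M} {W' : Set M'} {a a' : ℝ}
    (hW : IsOpen W) (hΛW : Prod.fst '' G ⊆ W) (ha : 0 < a)
    (hexp : ExpansiveOn f a W) (hshad : HasShadowing f W)
    (hW' : IsOpen W') (hΛ'W' : Prod.snd '' G ⊆ W') (ha' : 0 < a')
    (hexp' : ExpansiveOn f' a' W') (hshad' : HasShadowing f' W')
    (hpre : Premaximal f (Prod.fst '' G)) : Premaximal f' (Prod.snd '' G) := by
  intro U' hU' hΛ'U'
  have hΛ'c : IsCompact (Prod.snd '' G) := hG.image continuous_snd
  obtain ⟨ε₀, hε₀, hε₀U⟩ := hΛ'c.exists_cthickening_subset_open (hU'.inter hW')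
    (subset_inter hΛ'U' hΛ'W')
  obtain ⟨ε₁, hε₁, hback⟩ := hG.exists_dist_fst_lt hinj₁ (half_pos ha)
  obtain ⟨ε, hε, hεε₀, hεε₁, hεa⟩ : ∃ ε > 0, ε ≤ ε₀ ∧ 2 * ε < ε₁ ∧ ε ≤ a' / 8 :=
    ⟨min ε₀ (min (ε₁ / 3) (a' / 8)), by positivity, min_le_left _ _, by
      have := (min_le_right ε₀ (min (ε₁ / 3) (a' / 8))).trans (min_le_left _ _)
      linarith, (min_le_right _ _).trans (min_le_right _ _)⟩
  obtain ⟨δ', hδ', hsh'⟩ := hshad' ε hε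
  obtain ⟨κ, hκ, hforth⟩ : ∃ κ > 0, ∀ p ∈ G, ∀ q ∈ G, dist p.1 q.1 < κ →
      dist p.2 q.2 < min δ' (a' / 4) := by
    obtain ⟨κ, hκ, hforth⟩ := (hG.image continuous_swap).exists_dist_fst_lt
      (by rintro _ ⟨p, hp, rfl⟩ _ ⟨q, hq, rfl⟩; exact hinj₂ p hp q hq)
      (lt_min hδ' (by positivity : 0 < a' / 4))
    exact ⟨κ, hκ, fun p hp q hq =>
      hforth _ (mem_image_of_mem _ hp) _ (mem_image_of_mem _ hq)⟩
  obtain ⟨η₀, hη₀, -, hpseudo⟩ := exists_isPseudoOrbit_of_near_orbit f hκ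
  obtain ⟨η, hη, hηη₀, hηκ, hηa⟩ : ∃ η > 0, η ≤ η₀ ∧ 3 * η < κ ∧ η ≤ a / 4 :=
    ⟨min η₀ (min (κ / 4) (a / 4)), by positivity, min_le_left _ _, by
      have := (min_le_right η₀ (min (κ / 4) (a / 4))).trans (min_le_left _ _)
      linarith, (min_le_right _ _).trans (min_le_right _ _)⟩
  obtain ⟨L, hLc, hLinv, hLmax, hΛL, hLU⟩ := hpre (W ∩ thickening η (Prod.fst '' G))
    (hW.inter isOpen_thickening) (subset_inter hΛW (self_subset_thickening hη _))
  have hLW : L ⊆ W := hLU.trans inter_subset_left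
  -- the relation extending the conjugacy to `L`
  set S : Set (M × M') := {p | ∃ q ∈ G, dist p.1 q.1 ≤ η ∧ dist p.2 q.2 ≤ ε}
  set R : Set (M × M') := {p | p.1 ∈ L ∧ ∀ j, (hIter f j p.1, hIter f' j p.2) ∈ S}
  have hSU : ∀ p ∈ S, p.2 ∈ U' ∩ W' := by
    rintro p ⟨q, hq, -, hpq⟩
    exact hε₀U (mem_cthickening_of_dist_le _ _ _ _ (mem_image_of_mem _ hq) (hpq.trans hεε₀))
  have hRc : IsCompact R := by
    have : IsClosed R := by
      have hSc : IsClosed S := hG.isClosed_exists_dist_le η ε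
      simp only [R, ofPred_and, ofPred_forall]
      exact (hLc.isClosed.preimage continuous_fst).inter <| isClosed_iInter fun j => hSc.preimage
        (((continuous_hIter f j).comp continuous_fst).prodMk
          ((continuous_hIter f' j).comp continuous_snd))
    exact this.isCompact
  have hRiter : ∀ p ∈ R, ∀ n, (hIter f n p.1, hIter f' n p.2) ∈ R := by
    refine fun p hp n => ⟨hIter_mem f hLinv n hp.1, fun j => ?_⟩
    simpa only [hIter_add] using hp.2 (j + n)
  have hRS : ∀ p ∈ R, p ∈ S := fun p hp => by simpa only [hIter_zero] using hp.2 0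
  have hRW' : ∀ p ∈ R, ∀ n, hIter f' n p.2 ∈ W' := fun p hp n => (hSU _ (hp.2 n)).2
  have hRinj : ∀ p ∈ R, ∀ q ∈ R, p.2 = q.2 → p.1 = q.1 := by
    intro p hp q hq hpq
    refine hexp _ _ (fun n => hLW (hIter_mem f hLinv n hp.1))
      (fun n => hLW (hIter_mem f hLinv n hq.1)) fun n => ?_
    obtain ⟨u, hu, hu₁, hu₂⟩ := hp.2 n
    obtain ⟨v, hv, hv₁, hv₂⟩ := hq.2 n
    simp only [hpq] at hu₁ hu₂ hv₁ hv₂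
    have h₁ := dist_triangle_left u.2 v.2 (hIter f' n q.2)
    have h₂ := hback u hu v hv (by linarith)
    have h₃ := dist_triangle4_right (hIter f n p.1) (hIter f n q.1) u.1 v.1
    linarith
  have hRtotal : ∀ x ∈ L, ∃ x', (x, x') ∈ R := by
    intro x hx
    have hnear : ∀ j, ∃ q ∈ G, dist (hIter f j x) q.1 < η := by
      intro j
      obtain ⟨_, ⟨q, hq, rfl⟩, hd⟩ := mem_thickening_iff.1 (hLU (hIter_mem f hLinv j hx)).2
      exact ⟨q, hq, hd⟩
    choose q hqG hqd using hnear
    have hps := hpseudo x (fun j => (q j).1) fun j => (hqd j).trans_le hηη₀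
    obtain ⟨x', hx'⟩ := hsh' (fun j => (q j).2)
      (fun j => (hforth _ (hGf _ (hqG j)) _ (hqG (j + 1)) (hps j)).trans_le (min_le_left _ _))
      fun j => hΛ'W' (mem_image_of_mem _ (hqG j))
    exact ⟨x', hx, fun j => ⟨q j, hqG j, (hqd j).le, hx' j⟩⟩
  have hLc' : IsCompact (Prod.snd '' R) := hRc.image continuous_snd
  have hLiter : ∀ x ∈ Prod.snd '' R, ∀ n, hIter f' n x ∈ Prod.snd '' R := by
    rintro _ ⟨p, hp, rfl⟩ n
    exact ⟨_, hRiter p hp n, rfl⟩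
  refine ⟨Prod.snd '' R, hLc', image_eq_of_forall_hIter_mem f' hLiter, ?_, ?_, ?_⟩
  · -- local maximality
    obtain ⟨δ, hδ, hshL⟩ := hLmax.exists_shadows_mem hLc hLW hshad hη
    obtain ⟨σ, hσ, hRback⟩ := hRc.exists_dist_fst_lt hRinj hδ
    obtain ⟨ρ₀, hρ₀, -, hpseudo'⟩ := exists_isPseudoOrbit_of_near_orbit f' hσ
    set ρ := min ρ₀ (a' / 2)
    have hρpos : 0 < ρ := by positivity
    refine ⟨W' ∩ thickening ρ (Prod.snd '' R), hW'.inter isOpen_thickening, ?_, ?_⟩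
    · refine subset_inter ?_ (self_subset_thickening hρpos _)
      rintro _ ⟨p, hp, rfl⟩
      exact (hSU p (hRS p hp)).2
    refine Subset.antisymm (fun x hx => (mem_invSet f').2 fun n => ⟨?_, ?_⟩) fun z hz => ?_
    · obtain ⟨p, hp, rfl⟩ := hx
      exact hRW' p hp n
    · exact self_subset_thickening hρpos _ (hLiter x hx n)
    rw [mem_invSet] at hz
    have hnear : ∀ j, ∃ p ∈ R, dist (hIter f' j z) p.2 < ρ := by
      intro j
      obtain ⟨_, ⟨p, hp, rfl⟩, hd⟩ := mem_thickening_iff.1 (hz j).2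
      exact ⟨p, hp, hd⟩
    choose p hpR hpd using hnear
    have hps := hpseudo' z (fun j => (p j).2) fun j => (hpd j).trans_le (min_le_left _ _)
    obtain ⟨x, hxL, hx⟩ := hshL (fun j => (p j).1) (fun j => by
      have hfp := hRiter _ (hpR j) 1
      simp only [hIter_one] at hfp
      exact hRback _ hfp _ (hpR (j + 1)) (hps j)) fun j => (hpR j).1
    obtain ⟨x', hxx'⟩ := hRtotal x hxL
    suffices x' = z from this ▸ ⟨_, hxx', rfl⟩
    refine hexp' _ _ (hRW' _ hxx') (fun n => (hz n).1) fun n => ?_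
    obtain ⟨u, hu, hu₁, hu₂⟩ := hxx'.2 n
    obtain ⟨v, hv, hv₁, hv₂⟩ := hRS _ (hpR n)
    simp only at hu₁ hu₂
    have h₁ : dist u.1 v.1 ≤ dist (hIter f n x) u.1 + dist (hIter f n x) (p n).1
        + dist (p n).1 v.1 := by
      rw [dist_comm (hIter f n x) u.1]; exact dist_triangle4 _ _ _ _
    have h₂ := (hforth u hu v hv (by linarith [hx n])).trans_le (min_le_right _ _)
    have h₃ := dist_triangle4_right (hIter f' n x') (p n).2 u.2 v.2
    have h₄ := dist_triangle_right (hIter f' n x') (hIter f' n z) (p n).2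
    have h₅ := (hpd n).trans_le (min_le_right _ _)
    linarith
  · rintro _ ⟨p, hp, rfl⟩
    refine ⟨p, ⟨hΛL (mem_image_of_mem _ hp), fun j => ?_⟩, rfl⟩
    exact ⟨_, hIter_mem_graph hinj₂ hGf hΛinv hp j, by simpa using hη.le, by simpa using hε.le⟩
  · rintro _ ⟨p, hp, rfl⟩
    exact (hSU p (hRS p hp)).1

/-- premaximality is an intrinsic property: conjugate sets are
simultaneously premaximal. -/
theorem premaximal_is_intrinsic
    {M : Type*} [MetricSpace M] [CompactSpace M]
    {M' : Type*} [MetricSpace M'] [CompactSpace M']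
    (f : M ≃ₜ M) (f' : M' ≃ₜ M') (Λ : Set M) (Λ' : Set M')
    (hΛc : IsCompact Λ) (hΛinv : f '' Λ = Λ)
    (hΛ'c : IsCompact Λ') (hΛ'inv : f' '' Λ' = Λ')
    (W : Set M) (W' : Set M') (a a' : ℝ)
    (hW : IsOpen W) (hΛW : Λ ⊆ W) (ha : 0 < a)
    (hexp : ExpansiveOn f a W) (hshad : HasShadowing f W)
    (hW' : IsOpen W') (hΛ'W' : Λ' ⊆ W') (ha' : 0 < a')
    (hexp' : ExpansiveOn f' a' W') (hshad' : HasShadowing f' W')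
    (h : M → M')
    (hcont : ContinuousOn h Λ) (hinj : Set.InjOn h Λ) (himg : h '' Λ = Λ')
    (hconj : ∀ x ∈ Λ, h (f x) = f' (h x)) :
    Premaximal f Λ ↔ Premaximal f' Λ' := by
  have hG : IsCompact ((fun x => (x, h x)) '' Λ) := hΛc.image_of_continuousOn
    (continuousOn_id.prodMk hcont)
  have hfst : Prod.fst '' ((fun x => (x, h x)) '' Λ) = Λ := by simp [image_image]
  have hsnd : Prod.snd '' ((fun x => (x, h x)) '' Λ) = Λ' := by simp [image_image, himg]
  have hfst' : Prod.fst '' (Prod.swap '' ((fun x => (x, h x)) '' Λ)) = Λ' := by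
    simp [image_image, himg]
  have hsnd' : Prod.snd '' (Prod.swap '' ((fun x => (x, h x)) '' Λ)) = Λ := by
    simp [image_image]
  have hinj₁ : ∀ p ∈ (fun x => (x, h x)) '' Λ, ∀ q ∈ (fun x => (x, h x)) '' Λ,
      p.2 = q.2 → p.1 = q.1 := by
    rintro _ ⟨x, hx, rfl⟩ _ ⟨y, hy, rfl⟩ hxy
    exact hinj hx hy hxy
  have hinj₂ : ∀ p ∈ (fun x => (x, h x)) '' Λ, ∀ q ∈ (fun x => (x, h x)) '' Λ,
      p.1 = q.1 → p.2 = q.2 := by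
    rintro _ ⟨x, hx, rfl⟩ _ ⟨y, hy, rfl⟩ hxy
    exact congrArg h hxy
  have hGf : ∀ p ∈ (fun x => (x, h x)) '' Λ, (f p.1, f' p.2) ∈ (fun x => (x, h x)) '' Λ := by
    rintro _ ⟨x, hx, rfl⟩
    exact ⟨f x, hΛinv ▸ mem_image_of_mem f hx, by simp [hconj x hx]⟩
  constructor
  · intro hpre
    rw [← hsnd]
    exact Premaximal.of_graph hG hinj₁ hinj₂ hGf (by rwa [hfst]) hW (by rwa [hfst]) ha hexp hshad
      hW' (by rwa [hsnd]) ha' hexp' hshad' (by rwa [hfst])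
  · intro hpre
    rw [← hsnd']
    refine Premaximal.of_graph (hG.image continuous_swap) ?_ ?_ ?_ (by rwa [hfst']) hW'
      (by rwa [hfst']) ha' hexp' hshad' hW (by rwa [hsnd']) ha hexp hshad (by rwa [hfst'])
    · rintro _ ⟨p, hp, rfl⟩ _ ⟨q, hq, rfl⟩
      exact hinj₂ p hp q hq
    · rintro _ ⟨p, hp, rfl⟩ _ ⟨q, hq, rfl⟩
      exact hinj₁ p hp q hq
    · rintro _ ⟨p, hp, rfl⟩
      exact ⟨_, hGf p hp, rfl⟩
end
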